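/- arXiv:1510.02305 — 5 statements merged into one kernel-verified Lean document; each statement's English description precedes it below -/
import Mathlib

section
/- Let k ≥ 2 be an integer, set q = 2^{2k} and d = (2^{2k} − 1)/3, and let ω ≥ 3 be an integer such that for every positive divisor d' of 2^{2k+1} − 1 with d' < d, ω ≥ ((2^{2k+1}−1)/d' − ⌈(q−d−1)/d'⌉)/(⌈d/d'⌉ − 1) + 1 (as real numbers). Then the ω-tuple (d, d, …, d, 2d) (with d repeated ω−1 times) is realizable over the field GF(2^{2k}), is NOT realizable over the field GF(2^{2k+1}), and is not realizable over any finite field of order less than 2^{2k}. -/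
/-- `Realizable F ω d` : there are subsets `S i ⊆ F \ {0}` with `|S i| = d i` such that
`(-1)^(ω-1)` is not in the product set `S 1 ⋯ S ω`. -/
def Realizable (F : Type*) [Field F] (ω : ℕ) (d : Fin ω → ℕ) : Prop :=
  ∃ S : Fin ω → Finset F,
    (∀ i, (0 : F) ∉ S i) ∧ (∀ i, (S i).card = d i) ∧
    ∀ a : Fin ω → F, (∀ i, a i ∈ S i) → (-1 : F) ^ (ω - 1) ≠ ∏ i, a i

section Aux
open Pointwise

section Kneser
set_option linter.unusedSectionVars false
variable {G : Type*} [CommGroup G] [Finite G]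

theorem mem_stab_iff (s : Set G) (g : G) :
    g ∈ MulAction.stabilizer G s ↔ ∀ x ∈ s, g * x ∈ s := by
  rw [MulAction.mem_stabilizer_set_iff_smul_set_subset (Set.toFinite s)]
  constructor
  · intro h x hx
    exact h ⟨x, hx, rfl⟩
  · rintro h _ ⟨x, hx, rfl⟩
    exact h x hx

theorem subset_mulH (A : Set G) (H : Subgroup G) : A ⊆ A * (H : Set G) :=
  fun x hx => ⟨x, hx, 1, H.one_mem, by simp⟩

theorem stab_mul (s : Set G) : s * (MulAction.stabilizer G s : Set G) = s := by
  apply Set.Subset.antisymm _ (subset_mulH _ _)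
  rintro _ ⟨x, hx, h, hh, rfl⟩
  have := (mem_stab_iff s h).1 hh x hx
  simpa [mul_comm] using this

theorem dvd_card_mulH (A : Set G) (H : Subgroup G) : Nat.card H ∣ (A * (H : Set G)).ncard := by
  have h : (A * (H : Set G)) = (QuotientGroup.mk (s := H)) ⁻¹' ((QuotientGroup.mk (s := H)) '' A) := by
    rw [QuotientGroup.preimage_image_mk_eq_mul]
  rw [h, ← Nat.card_coe_set_eq, Nat.card_congr (QuotientGroup.preimageMkEquivSubgroupProdSet _ _),
    Nat.card_prod]
  exact dvd_mul_right _ _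

theorem mulH_mul (A B : Set G) (H : Subgroup G) (h : A * B * (H : Set G) = A * B) :
    (A * (H : Set G)) * (B * (H : Set G)) = A * B := by
  rw [mul_mul_mul_comm, coe_mul_coe, h]

theorem ncard_coset (a : G) (H : Subgroup G) : (a • (H : Set G)).ncard = Nat.card H := by
  rw [Set.ncard_smul_set]; rfl

theorem mem_coset (a x : G) (H : Subgroup G) : x ∈ a • (H : Set G) ↔ a⁻¹ * x ∈ H := by
  rw [Set.mem_smul_set_iff_inv_smul_mem]; rfl

/-- lower bound for one coset. -/
theorem coset_bound (A B : Set G) (H H' : Subgroup G) (hH : H' ≤ H) (x : G) (hx : x ∈ A ∪ B) :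
    ((A ∪ B) * (H' : Set G)).ncard + Nat.card H ≤ ((A ∪ B) * (H : Set G)).ncard +
      ((A ∩ x • (H : Set G)) * (H' : Set G)).ncard +
      ((B ∩ x • (H : Set G)) * (H' : Set G)).ncard := by
  set U := (A ∪ B) * (H' : Set G)
  set W := (A ∪ B) * (H : Set G)
  set P := (A ∩ x • (H : Set G)) * (H' : Set G)
  set Q := (B ∩ x • (H : Set G)) * (H' : Set G)
  have h1 : U ∪ x • (H : Set G) ⊆ W := by
    apply Set.union_subset
    · exact Set.mul_subset_mul_left hH
    · rintro _ ⟨h, hh, rfl⟩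
      exact ⟨x, hx, h, hh, rfl⟩
  have h2 : U ∩ x • (H : Set G) ⊆ P ∪ Q := by
    rintro _ ⟨⟨y, hy, h, hh, rfl⟩, hz⟩
    rw [mem_coset] at hz
    have hyx : y ∈ x • (H : Set G) := by
      rw [mem_coset]
      have := H.mul_mem hz (H.inv_mem (hH hh))
      simpa [mul_assoc] using this
    rcases hy with hy | hy
    · exact Or.inl ⟨y, ⟨hy, hyx⟩, h, hh, rfl⟩
    · exact Or.inr ⟨y, ⟨hy, hyx⟩, h, hh, rfl⟩
  have h3 := Set.ncard_union_add_ncard_inter U (x • (H : Set G))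
  have h4 := Set.ncard_le_ncard h1
  have h5 := Set.ncard_le_ncard h2
  have h6 := Set.ncard_union_le P Q
  rw [ncard_coset] at h3
  omega

theorem two_coset_bound (A B : Set G) (H : Subgroup G) (a b : G) (ha : a ∈ A) (hb : b ∈ B)
    (hab : a⁻¹ * b ∉ H) :
    (A ∪ B).ncard + 2 * Nat.card H ≤ ((A ∪ B) * (H : Set G)).ncard +
      (A ∩ a • (H : Set G)).ncard + (B ∩ a • (H : Set G)).ncard +
      (A ∩ b • (H : Set G)).ncard + (B ∩ b • (H : Set G)).ncard := by
  set W := (A ∪ B) * (H : Set G)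
  have hdis : Disjoint (a • (H : Set G)) (b • (H : Set G)) := by
    rw [Set.disjoint_left]
    intro z hz hz'
    rw [mem_coset] at hz hz'
    apply hab
    have := H.mul_mem hz (H.inv_mem hz')
    simpa [mul_assoc] using this
  have h0 := Set.ncard_union_eq hdis
  rw [ncard_coset, ncard_coset] at h0
  have h1 : (A ∪ B) ∪ (a • (H : Set G) ∪ b • (H : Set G)) ⊆ W := by
    apply Set.union_subset (subset_mulH _ _)
    apply Set.union_subset
    · rintro _ ⟨h, hh, rfl⟩
      exact ⟨a, Or.inl ha, h, hh, rfl⟩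
    · rintro _ ⟨h, hh, rfl⟩
      exact ⟨b, Or.inr hb, h, hh, rfl⟩
  have h2 : (A ∪ B) ∩ (a • (H : Set G) ∪ b • (H : Set G)) ⊆
      ((A ∩ a • (H : Set G)) ∪ (B ∩ a • (H : Set G))) ∪
      ((A ∩ b • (H : Set G)) ∪ (B ∩ b • (H : Set G))) := by
    intro z hz
    simp only [Set.mem_inter_iff, Set.mem_union] at hz ⊢
    tauto
  have h3 := Set.ncard_union_add_ncard_inter (A ∪ B) (a • (H : Set G) ∪ b • (H : Set G))
  have h4 := Set.ncard_le_ncard h1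
  have h5 := Set.ncard_le_ncard h2
  have h6 := Set.ncard_union_le ((A ∩ a • (H : Set G)) ∪ (B ∩ a • (H : Set G))) ((A ∩ b • (H : Set G)) ∪ (B ∩ b • (H : Set G)))
  have h7 := Set.ncard_union_le (A ∩ a • (H : Set G)) (B ∩ a • (H : Set G))
  have h8 := Set.ncard_union_le (A ∩ b • (H : Set G)) (B ∩ b • (H : Set G))
  omega

/-- The weak Kneser inequality. -/
def Kn (A B : Set G) : Prop :=
  A.ncard + B.ncard ≤ (A * B).ncard + Nat.card (MulAction.stabilizer G (A * B))

/-- convergent -/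
def Conv (A B : Set G) (H : Subgroup G) (C : Set G) : Prop :=
  C ⊆ A * B ∧ C.Nonempty ∧ C * (H : Set G) = C ∧
    (A ∩ B).ncard + ((A ∪ B) * (H : Set G)).ncard ≤ C.ncard + Nat.card H

theorem sub_step (A B : Set G)
    (IH1 : ∀ A' B' : Set G, A'.Nonempty → B'.Nonempty → (A' * B').ncard < (A * B).ncard → Kn A' B')
    (H : Subgroup G) (C : Set G) (hC : Conv A B H C)
    (hmin : ∀ H' C', Conv A B H' C' → Nat.card H ≤ Nat.card H')
    (a b : G) (x : G) (hx : x ∉ A * B) (hxH : (a * b)⁻¹ * x ∈ H)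
    (A1 B1 : Set G) (hA1 : A1 = A ∩ a • (H : Set G)) (hB1 : B1 = B ∩ b • (H : Set G))
    (hA1n : A1.Nonempty) (hB1n : B1.Nonempty) :
    ∃ H1 : Subgroup G, H1 ≤ H ∧
      ((A ∪ B) * (H : Set G)).ncard + (A1 * (H1 : Set G)).ncard + (B1 * (H1 : Set G)).ncard
        < ((A ∪ B) * (H1 : Set G)).ncard + Nat.card H ∧
      (A1 * (H1 : Set G)).ncard + (B1 * (H1 : Set G)).ncard + Nat.card H1 ≤ Nat.card H ∧
      ((A1 * (H1 : Set G)).ncard + (B1 * (H1 : Set G)).ncard ≤ (A1 * B1).ncard + Nat.card H1) ∧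
      C.ncard + (A1 * B1).ncard ≤ (A * B).ncard := by
  obtain ⟨hCs, hCn, hCH, hCc⟩ := hC
  have hsub : A1 * B1 ⊆ A * B := by
    apply Set.mul_subset_mul
    · rw [hA1]; exact Set.inter_subset_left
    · rw [hB1]; exact Set.inter_subset_left
  have hcos : ∀ z ∈ A1 * B1, (a * b)⁻¹ * z ∈ H := by
    rintro _ ⟨u, hu, v, hv, rfl⟩
    rw [hA1] at hu
    rw [hB1] at hv
    have h1 := (mem_coset _ _ _).1 hu.2
    have h2 := (mem_coset _ _ _).1 hv.2
    have := H.mul_mem h1 h2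
    convert this using 1
    simp only [mul_inv]
    exact mul_mul_mul_comm _ _ _ _
  have hdis : Disjoint C (A1 * B1) := by
    rw [Set.disjoint_left]
    intro z hz hz'
    apply hx
    apply hCs
    rw [← hCH]
    refine ⟨z, hz, z⁻¹ * x, ?_, by simp⟩
    have := H.mul_mem (H.inv_mem (hcos z hz')) hxH
    have e : z⁻¹ * x = ((a * b)⁻¹ * z)⁻¹ * ((a * b)⁻¹ * x) := by group
    rw [e]
    exact this
  have hcard : C.ncard + (A1 * B1).ncard ≤ (A * B).ncard := by
    rw [← Set.ncard_union_eq hdis]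
    exact Set.ncard_le_ncard (Set.union_subset hCs hsub)
  have hCpos : 0 < C.ncard := (Set.ncard_pos).2 hCn
  set H1 := MulAction.stabilizer G (A1 * B1) with hH1
  have hst : A1 * B1 * (H1 : Set G) = A1 * B1 := stab_mul _
  have hmm := mulH_mul A1 B1 H1 hst
  have hkn := IH1 (A1 * (H1 : Set G)) (B1 * (H1 : Set G))
    (hA1n.mono (subset_mulH _ _)) (hB1n.mono (subset_mulH _ _)) (by rw [hmm]; omega)
  unfold Kn at hkn
  rw [hmm, ← hH1] at hkn
  obtain ⟨z, hz⟩ := hA1n.mul hB1n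
  have hle : H1 ≤ H := by
    intro h hh
    have h1 := (mem_stab_iff _ h).1 hh z hz
    have := H.mul_mem (hcos _ h1) (H.inv_mem (hcos z hz))
    convert this using 1
    rw [mul_left_comm, mul_assoc, mul_inv_cancel, mul_one]
  have hne : ¬ H ≤ H1 := by
    intro hle'
    apply hx
    apply hsub
    rw [← hst]
    refine ⟨z, hz, z⁻¹ * x, hle' ?_, by simp⟩
    have := H.mul_mem (H.inv_mem (hcos z hz)) hxH
    convert this using 1
    group
  have hlt : Nat.card H1 < Nat.card H := by
    by_contra hcon
    push Not at hcon
    exact hne (Subgroup.eq_of_le_of_card_ge hle hcon).ge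
  have hnc : ¬ Conv A B H1 (C ∪ A1 * B1) := by
    intro hc
    have := hmin _ _ hc
    omega
  have hnc' : C.ncard + (A1 * B1).ncard + Nat.card H1 <
      (A ∩ B).ncard + ((A ∪ B) * (H1 : Set G)).ncard := by
    by_contra hcon
    push Not at hcon
    apply hnc
    refine ⟨Set.union_subset hCs hsub, hCn.mono Set.subset_union_left, ?_, ?_⟩
    · rw [Set.union_mul, hst]
      congr 1
      apply Set.Subset.antisymm _ (subset_mulH _ _)
      conv_rhs => rw [← hCH]
      exact Set.mul_subset_mul_left hle
    · rw [Set.ncard_union_eq hdis]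
      exact hcon
  have hmono : ((A ∪ B) * (H1 : Set G)).ncard ≤ ((A ∪ B) * (H : Set G)).ncard :=
    Set.ncard_le_ncard (Set.mul_subset_mul_left hle)
  refine ⟨H1, hle, by omega, ?_, hkn, hcard⟩
  obtain ⟨u, hu⟩ := dvd_card_mulH A1 H1
  obtain ⟨v, hv⟩ := dvd_card_mulH B1 H1
  obtain ⟨w, hw⟩ := Subgroup.card_dvd_of_le hle
  have hlt2 : (A1 * (H1 : Set G)).ncard + (B1 * (H1 : Set G)).ncard < Nat.card H := by omega
  rw [hu, hv, hw, ← mul_add] at hlt2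
  have := lt_of_mul_lt_mul_left hlt2 (Nat.zero_le _)
  rw [hu, hv, hw]
  calc _ = Nat.card H1 * (u + v + 1) := by ring
    _ ≤ _ := Nat.mul_le_mul_left _ this

theorem core (A B : Set G) (hAB : (A ∩ B).Nonempty)
    (IH1 : ∀ A' B' : Set G, A'.Nonempty → B'.Nonempty → (A' * B').ncard < (A * B).ncard → Kn A' B')
    (IH2 : ∀ B' : Set G, B'.Nonempty → ((A ∩ B) * B').ncard ≤ (A * B).ncard → Kn (A ∩ B) B') :
    Kn A B := by
  have hUn : (A ∪ B).Nonempty := hAB.mono (fun x hx => Or.inl hx.1)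
  have hsub0 : (A ∩ B) * (A ∪ B) ⊆ A * B := by
    rintro _ ⟨u, hu, v, hv | hv, rfl⟩
    · exact ⟨v, hv, u, hu.2, mul_comm _ _⟩
    · exact ⟨u, hu.1, v, hv, rfl⟩
  have hex : ∃ H : Subgroup G, ∃ C, Conv A B H C := by
    set H0 := MulAction.stabilizer G ((A ∩ B) * (A ∪ B)) with hH0
    have hst : (A ∩ B) * (A ∪ B) * (H0 : Set G) = (A ∩ B) * (A ∪ B) := stab_mul _
    refine ⟨H0, (A ∩ B) * (A ∪ B), hsub0, hAB.mul hUn, hst, ?_⟩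
    have := IH2 ((A ∪ B) * (H0 : Set G)) (hUn.mono (subset_mulH _ _))
      (by rw [← mul_assoc, hst]; exact Set.ncard_le_ncard hsub0)
    unfold Kn at this
    rwa [← mul_assoc, hst] at this
  obtain ⟨H, ⟨C, hC⟩, hmin⟩ := Set.exists_min_image {H : Subgroup G | ∃ C, Conv A B H C}
    (fun H => Nat.card H) (Set.toFinite _) hex
  have hmin' : ∀ H' C', Conv A B H' C' → Nat.card H ≤ Nat.card H' :=
    fun H' C' h => hmin H' ⟨C', h⟩
  have hui := Set.ncard_union_add_ncard_inter A B
  have hCc := hC.2.2.2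
  have hUle : (A ∪ B).ncard ≤ ((A ∪ B) * (H : Set G)).ncard :=
    Set.ncard_le_ncard (subset_mulH _ _)
  by_contra hkn
  unfold Kn at hkn
  set K := MulAction.stabilizer G (A * B) with hK
  have hHK : ¬ H ≤ K := by
    intro hle
    have h1 := Set.ncard_le_ncard hC.1
    have h2 : Nat.card H ≤ Nat.card K := Nat.le_of_dvd Nat.card_pos (Subgroup.card_dvd_of_le hle)
    omega
  obtain ⟨h, hh, hhK⟩ := SetLike.not_le_iff_exists.1 hHK
  rw [hK, mem_stab_iff] at hhK
  push Not at hhK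
  obtain ⟨_, ⟨a, ha, b, hb, rfl⟩, hx⟩ := hhK
  have hxH : (a * b)⁻¹ * (h * (a * b)) ∈ H := by
    rw [mul_comm h, inv_mul_cancel_left]; exact hh
  have hxH' : (b * a)⁻¹ * (h * (a * b)) ∈ H := by
    rw [mul_comm b]; exact hxH
  have haa : a ∈ a • (H : Set G) := by rw [mem_coset]; simp
  have hbb : b ∈ b • (H : Set G) := by rw [mem_coset]; simp
  obtain ⟨H1, hle1, e1, f1, g1, c1⟩ := sub_step A B IH1 H C hC hmin' a b _ hx hxH _ _ rfl rfl
    ⟨a, ha, haa⟩ ⟨b, hb, hbb⟩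
  have ba := coset_bound A B H H1 hle1 a (Or.inl ha)
  have bb := coset_bound A B H H1 hle1 b (Or.inr hb)
  have hB2 : (B ∩ a • (H : Set G)).Nonempty := by
    by_contra hemp
    rw [Set.not_nonempty_iff_eq_empty] at hemp
    rw [hemp, Set.empty_mul, Set.ncard_empty] at ba
    omega
  have hA2 : (A ∩ b • (H : Set G)).Nonempty := by
    by_contra hemp
    rw [Set.not_nonempty_iff_eq_empty] at hemp
    rw [hemp, Set.empty_mul, Set.ncard_empty] at bb
    omega
  have hab : a⁻¹ * b ∉ H := by
    intro hin
    have : a • (H : Set G) = b • (H : Set G) := by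
      ext z
      rw [mem_coset, mem_coset]
      constructor
      · intro hz
        have := H.mul_mem (H.inv_mem hin) hz
        convert this using 1
        group
      · intro hz
        have := H.mul_mem hin hz
        convert this using 1
        group
    rw [this] at ba e1
    omega
  obtain ⟨H2, hle2, e2, f2, g2, c2⟩ := sub_step A B IH1 H C hC hmin' b a _ hx hxH' _ _ rfl rfl
    hA2 hB2
  have tb := two_coset_bound A B H a b ha hb hab
  have s1 := Set.ncard_le_ncard (subset_mulH (A ∩ a • (H : Set G)) H1)
  have s2 := Set.ncard_le_ncard (subset_mulH (B ∩ b • (H : Set G)) H1)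
  have s3 := Set.ncard_le_ncard (subset_mulH (A ∩ b • (H : Set G)) H2)
  have s4 := Set.ncard_le_ncard (subset_mulH (B ∩ a • (H : Set G)) H2)
  omega

theorem kneser_weak (m n : ℕ) : ∀ A B : Set G, A.Nonempty → B.Nonempty →
    (A * B).ncard = m → A.ncard = n → Kn A B := by
  induction m using Nat.strong_induction_on generalizing n with
  | _ m ihm =>
  induction n using Nat.strong_induction_on with
  | _ n ihn =>
  intro A B hA hB hm hn
  have IH1 : ∀ A' B' : Set G, A'.Nonempty → B'.Nonempty → (A' * B').ncard < (A * B).ncard →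
      Kn A' B' := fun A' B' h1 h2 h3 => ihm _ (hm ▸ h3) _ A' B' h1 h2 rfl rfl
  have IH2 : ∀ A' B' : Set G, A'.Nonempty → B'.Nonempty → (A' * B').ncard ≤ (A * B).ncard →
      A'.ncard < A.ncard → Kn A' B' := by
    intro A' B' h1 h2 h3 h4
    rcases h3.lt_or_eq with h | h
    · exact IH1 _ _ h1 h2 h
    · exact ihn _ (hn ▸ h4) A' B' h1 h2 (h.trans hm) rfl
  by_cases hg : ∃ g : G, (A ∩ g • B).Nonempty ∧ ¬ A ⊆ g • B
  · obtain ⟨g, hg1, hg2⟩ := hg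
    have hprod : A * (g • B) = g • (A * B) := mul_smul_comm _ _ _
    have hcard : (A * (g • B)).ncard = (A * B).ncard := by rw [hprod, Set.ncard_smul_set]
    have hstab : MulAction.stabilizer G (A * (g • B)) = MulAction.stabilizer G (A * B) := by
      rw [hprod]
      ext h
      rw [MulAction.mem_stabilizer_iff, MulAction.mem_stabilizer_iff, smul_comm,
        smul_left_cancel_iff]
    have hlt : (A ∩ g • B).ncard < A.ncard := by
      refine Set.ncard_lt_ncard ⟨Set.inter_subset_left, fun h => hg2 (fun x hx => (h hx).2)⟩ (Set.toFinite _)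
    have := core A (g • B) hg1 (by rw [hcard]; exact IH1)
      (fun B' hB' hle => IH2 _ _ hg1 hB' (by rwa [hcard] at hle) hlt)
    unfold Kn at this ⊢
    rwa [hstab, hcard, Set.ncard_smul_set] at this
  · push Not at hg
    unfold Kn
    obtain ⟨a, ha⟩ := hA
    have h1 : A ⊆ a • (MulAction.stabilizer G (A * B) : Set G) := by
      intro a' ha'
      rw [mem_coset, mem_stab_iff]
      rintro _ ⟨u, hu, b, hb, rfl⟩
      have := hg (a * b⁻¹) ⟨a, ha, ⟨b, hb, by simp⟩⟩ ha'
      rw [Set.mem_smul_set_iff_inv_smul_mem] at this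
      refine ⟨u, hu, _, this, ?_⟩
      simp only [smul_eq_mul, mul_inv, inv_inv]
      simp only [mul_comm, mul_left_comm, mul_assoc]
    have h2 := Set.ncard_le_ncard h1
    rw [ncard_coset] at h2
    have h3 : a • B ⊆ A * B := by
      rintro _ ⟨b, hb, rfl⟩
      exact ⟨a, ha, b, hb, rfl⟩
    have h4 := Set.ncard_le_ncard h3
    rw [Set.ncard_smul_set] at h4
    omega

theorem stab_le_stab_mul (A B : Set G) :
    MulAction.stabilizer G B ≤ MulAction.stabilizer G (A * B) := by
  intro g hg
  rw [mem_stab_iff] at hg ⊢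
  rintro _ ⟨a, ha, b, hb, rfl⟩
  exact ⟨a, ha, g * b, hg b hb, mul_left_comm _ _ _⟩

theorem kneser_multi {ι : Type*} [DecidableEq ι] (K : Subgroup G) (f : ι → Set G)
    (s : Finset ι) (hf : ∀ i ∈ s, (f i).Nonempty)
    (hK : MulAction.stabilizer G ((∏ i ∈ s, f i) * (K : Set G)) ≤ K) :
    ∑ i ∈ s, (f i * (K : Set G)).ncard + Nat.card K ≤
      ((∏ i ∈ s, f i) * (K : Set G)).ncard + s.card * Nat.card K := by
  induction s using Finset.induction_on with
  | empty => simp; rfl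
  | insert j s hj ih =>
    rw [Finset.prod_insert hj, mul_assoc] at hK
    have h1 := ih (fun i hi => hf i (Finset.mem_insert_of_mem hi))
      ((stab_le_stab_mul _ _).trans hK)
    have hP : ((∏ i ∈ s, f i) * (K : Set G)).Nonempty := by
      refine Set.Nonempty.mul ?_ ⟨1, K.one_mem⟩
      choose! g hg using fun i (hi : i ∈ s) => hf i (Finset.mem_insert_of_mem hi)
      exact ⟨∏ i ∈ s, g i, Set.finsetProd_mem_finsetProd _ _ _ hg⟩
    have h2 := kneser_weak _ _ (f j * (K : Set G)) ((∏ i ∈ s, f i) * (K : Set G))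
      ((hf j (Finset.mem_insert_self _ _)).mono (subset_mulH _ _)) hP rfl rfl
    unfold Kn at h2
    have h3 : f j * (K : Set G) * ((∏ i ∈ s, f i) * (K : Set G)) =
        f j * ((∏ i ∈ s, f i) * (K : Set G)) := by
      rw [mul_mul_mul_comm, coe_mul_coe, mul_assoc]
    rw [h3] at h2
    have h4 := Nat.le_of_dvd Nat.card_pos (Subgroup.card_dvd_of_le hK)
    rw [Finset.prod_insert hj, Finset.sum_insert hj, Finset.card_insert_of_notMem hj, mul_assoc,
      add_mul]
    omega

end Kneser

theorem prod_cover {G : Type*} [CommGroup G] [Finite G] (w d : ℕ) (hd : 2 ≤ d)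
    (hG : Nat.card G = 6 * d + 1) (h5 : ¬ 5 ∣ 6 * d + 1)
    (f : Fin (w + 1) → Set G)
    (hf : ∀ i, (f i).ncard = if (i : ℕ) = w then 2 * d else d)
    (hb : ∀ d' : ℕ, 0 < d' → d' ∣ 6 * d + 1 → d' < d →
      ((w : ℝ) + 1) ≥ ((6 * (d : ℝ) + 1) / (d' : ℝ) - (⌈(2 * (d : ℝ)) / (d' : ℝ)⌉ : ℝ))
          / ((⌈(d : ℝ) / (d' : ℝ)⌉ : ℝ) - 1) + 1) :
    ∏ i, f i = Set.univ := by
  classical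
  by_contra hne
  set P := ∏ i, f i with hP
  set K := MulAction.stabilizer G P with hK
  have hfn : ∀ i, (f i).Nonempty := by
    intro i
    rw [← Set.ncard_pos, hf]
    split_ifs <;> omega
  have hPn : P.Nonempty := by
    choose g hg using hfn
    exact ⟨∏ i, g i, Set.finsetProd_mem_finsetProd _ _ _ (fun i _ => hg i)⟩
  have hPK : P * (K : Set G) = P := stab_mul P
  have hkn := kneser_multi K f Finset.univ (fun i _ => hfn i) (by rw [← hP, hPK])
  rw [← hP, hPK, Finset.card_univ, Fintype.card_fin] at hkn
  have hdvd : Nat.card K ∣ 6 * d + 1 := hG ▸ Subgroup.card_subgroup_dvd_card K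
  have hpos : 0 < Nat.card K := Nat.card_pos
  have hlt : P.ncard < 6 * d + 1 := by
    rw [← hG, ← Set.ncard_univ]
    exact Set.ncard_lt_ncard (Set.ssubset_univ_iff.2 hne) (Set.toFinite _)
  have hKP : Nat.card K ≤ P.ncard := by
    obtain ⟨z, hz⟩ := hPn
    rw [← ncard_coset z K]
    apply Set.ncard_le_ncard _ (Set.toFinite _)
    rintro _ ⟨h, hh, rfl⟩
    rw [← hPK]
    exact ⟨z, hz, h, hh, rfl⟩
  choose c hc using fun i => dvd_card_mulH (f i) K
  obtain ⟨m, hm⟩ := hdvd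
  set D := Nat.card K with hD
  have hDd : D < d := by
    by_contra hcon
    push Not at hcon
    have hm6 : m ≤ 6 := by
      by_contra h7
      push Not at h7
      have : d * 7 ≤ D * m := Nat.mul_le_mul hcon h7
      omega
    interval_cases m <;> omega
  have hb' := hb D hpos ⟨m, hm⟩ hDd
  have hDR : (0 : ℝ) < D := by exact_mod_cast hpos
  have e1 : (6 * (d : ℝ) + 1) / (D : ℝ) = m := by
    rw [div_eq_iff hDR.ne']
    have : ((6 * d + 1 : ℕ) : ℝ) = ((D * m : ℕ) : ℝ) := by rw [hm]
    push_cast at this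
    linarith
  rw [e1] at hb'
  set γ := ⌈(d : ℝ) / (D : ℝ)⌉ with hγ
  set ε := ⌈(2 * (d : ℝ)) / (D : ℝ)⌉ with hε
  have hγ1 : 1 < γ := by
    rw [hγ, Int.lt_ceil]
    rw [lt_div_iff₀ hDR]
    push_cast
    rw [one_mul]
    exact_mod_cast hDd
  have hγR : (0 : ℝ) < (γ : ℝ) - 1 := by
    have : (1 : ℝ) < γ := by exact_mod_cast hγ1
    linarith
  have hb2 : ((m : ℝ) - ε) ≤ w * ((γ : ℝ) - 1) := by
    rw [← div_le_iff₀ hγR]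
    linarith
  have hb3 : (m : ℤ) - ε ≤ w * (γ - 1) := by exact_mod_cast hb2
  have hci : ∀ i, (f i).ncard ≤ D * c i := by
    intro i
    rw [← hc i]
    exact Set.ncard_le_ncard (subset_mulH _ _) (Set.toFinite _)
  have hcast : ∀ i : Fin w, γ ≤ c i.castSucc := by
    intro i
    rw [hγ, Int.ceil_le, div_le_iff₀ hDR]
    have := hci i.castSucc
    rw [hf, if_neg (by simp; omega)] at this
    have h2 : (d : ℝ) ≤ D * c i.castSucc := by exact_mod_cast this
    push_cast
    linarith
  have hlast : ε ≤ c (Fin.last w) := by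
    rw [hε, Int.ceil_le, div_le_iff₀ hDR]
    have := hci (Fin.last w)
    rw [hf, if_pos (by simp)] at this
    have h2 : 2 * (d : ℝ) ≤ D * c (Fin.last w) := by exact_mod_cast this
    push_cast
    linarith
  have hsum : (w : ℤ) * γ + ε ≤ ((∑ i, c i : ℕ) : ℤ) := by
    rw [Fin.sum_univ_castSucc]
    push_cast
    have : ∑ i : Fin w, γ ≤ ∑ i : Fin w, (c i.castSucc : ℤ) :=
      Finset.sum_le_sum (fun i _ => hcast i)
    simp at this
    linarith
  simp only [hc] at hkn
  rw [← Finset.mul_sum] at hkn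
  have h3 : D * (∑ i, c i + 1) < D * (m + (w + 1)) := by
    have e2 : D * (m + (w + 1)) = D * m + (w + 1) * D := by ring
    have e3 : D * (∑ i, c i + 1) = D * (∑ i, c i) + D := by ring
    omega
  have h4 := lt_of_mul_lt_mul_left h3 (Nat.zero_le _)
  have h5 : ((∑ i, c i : ℕ) : ℤ) < m + w := by
    have : ∑ i, c i < m + w := by omega
    exact_mod_cast this
  have : (w : ℤ) * (γ - 1) = w * γ - w := by ring
  linarith

theorem part_one {F : Type} [Field F] [Fintype F] (k d w : ℕ)
    (hF : Fintype.card F = 3 * d + 1) (h2 : 3 * d + 1 = 2 ^ (2 * k)) :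
    Realizable F (w + 1) (fun i => if (i : ℕ) = w + 1 - 1 then 2 * d else d) := by
  classical
  have hd0 : 0 < d := by
    by_contra h
    have : d = 0 := by omega
    subst this
    have := Fintype.one_lt_card (α := F)
    omega
  have hm1 : (-1 : F) = 1 := by
    have : ((Fintype.card F : ℕ) : F) = 0 := FiniteField.cast_card_eq_zero F
    rw [hF, h2] at this
    push_cast at this
    have h20 : (2 : F) = 0 := eq_zero_of_pow_eq_zero this
    have : (1 : F) + 1 = 0 := by rw [one_add_one_eq_two]; exact h20
    exact (eq_neg_of_add_eq_zero_left this).symm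
  have hcu : Fintype.card Fˣ = 3 * d := by
    rw [Fintype.card_units, hF]; simp
  set T : Finset Fˣ := Finset.univ.filter (fun x => x ^ d = 1) with hT
  have hTc : T.card = d := by
    have h1 := IsCyclic.card_powMonoidHom_ker Fˣ d
    rw [Nat.card_eq_fintype_card (α := Fˣ), hcu, Nat.gcd_eq_right (dvd_mul_left _ _)] at h1
    conv_rhs => rw [← h1]
    rw [← Fintype.card_coe, ← Nat.card_eq_fintype_card]
    apply Nat.card_congr
    apply Equiv.subtypeEquivRight
    intro x
    simp [hT, MonoidHom.mem_ker]
  set emb : Fˣ ↪ F := ⟨Units.val, Units.val_injective⟩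
  refine ⟨fun i => if (i : ℕ) = w + 1 - 1 then Tᶜ.map emb else T.map emb, ?_, ?_, ?_⟩
  · intro i
    dsimp only
    split_ifs <;> simp [emb]
  · intro i
    dsimp only
    split_ifs
    · rw [Finset.card_map, Finset.card_compl, hcu, hTc]; omega
    · rw [Finset.card_map, hTc]
  · intro a ha hprod
    rw [hm1, one_pow, Fin.prod_univ_castSucc] at hprod
    have h1 : ∀ i : Fin w, (a i.castSucc) ^ d = 1 := by
      intro i
      have := ha i.castSucc
      dsimp only at this
      rw [if_neg (by simp; omega)] at this
      simp only [Finset.mem_map, hT, Finset.mem_filter, emb] at this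
      obtain ⟨u, ⟨_, hu⟩, hua⟩ := this
      rw [← hua]
      change (u : F) ^ d = 1
      rw [← Units.val_pow_eq_pow_val, hu, Units.val_one]
    have h3 := ha (Fin.last w)
    dsimp only at h3
    rw [if_pos (by simp)] at h3
    simp only [Finset.mem_map, hT, Finset.mem_compl, Finset.mem_filter, emb] at h3
    obtain ⟨u, hu, hua⟩ := h3
    apply hu
    refine ⟨Finset.mem_univ _, ?_⟩
    have h4 := congrArg (· ^ d) hprod
    simp only [one_pow, mul_pow, ← Finset.prod_pow, h1, Finset.prod_const_one, one_mul] at h4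
    rw [← hua] at h4
    apply Units.ext
    simpa using h4.symm

theorem part_three {F : Type} [Field F] [Fintype F] (d w : ℕ) (hw : 1 ≤ w) (hd : 1 ≤ d)
    (hF : Fintype.card F < 3 * d + 1) :
    ¬ Realizable F (w + 1) (fun i => if (i : ℕ) = w + 1 - 1 then 2 * d else d) := by
  classical
  rintro ⟨S, h0, hc, hS⟩
  dsimp only at hc
  obtain ⟨v, rfl⟩ : ∃ v, w = v + 1 := ⟨w - 1, by omega⟩
  have hne : ∀ i, (S i).Nonempty := by
    intro i
    rw [← Finset.card_pos, hc]
    split_ifs <;> omega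
  choose g hg using hne
  have hg0 : ∀ i, g i ≠ 0 := fun i h => h0 i (h ▸ hg i)
  set r : F := ∏ i : Fin v, g i.castSucc.castSucc with hr
  have hr0 : r ≠ 0 := Finset.prod_ne_zero_iff.2 (fun i _ => hg0 _)
  set t : F := (-1) ^ (v + 1 + 1 - 1) / r with ht
  have ht0 : t ≠ 0 := div_ne_zero (pow_ne_zero _ (by simp)) hr0
  set X := S (Fin.last v).castSucc with hX
  set Y := (S (Fin.last (v + 1))).image (fun y => t / y) with hY
  have hXc : X.card = d := by rw [hX, hc, if_neg (by simp)]
  have hYc : Y.card = 2 * d := by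
    rw [hY, Finset.card_image_of_injective, hc, if_pos (by simp)]
    intro y z h
    simp only [div_eq_mul_inv] at h
    exact inv_injective (mul_left_cancel₀ ht0 h)
  have hnd : ¬ Disjoint X Y := by
    intro hdis
    have h1 : X ∪ Y ⊆ Finset.univ.erase 0 := by
      intro z hz
      rw [Finset.mem_erase]
      refine ⟨?_, Finset.mem_univ _⟩
      rintro rfl
      rcases Finset.mem_union.1 hz with hz | hz
      · exact h0 _ hz
      · obtain ⟨y, hy, hy2⟩ := Finset.mem_image.1 hz
        have : y ≠ 0 := fun h => h0 _ (h ▸ hy)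
        exact div_ne_zero ht0 this hy2
    have h2 := Finset.card_le_card h1
    rw [Finset.card_union_of_disjoint hdis, hXc, hYc, Finset.card_erase_of_mem (Finset.mem_univ _),
      Finset.card_univ] at h2
    omega
  obtain ⟨x, hx, hxy⟩ := Finset.not_disjoint_iff.1 hnd
  obtain ⟨y, hy, hyx⟩ := Finset.mem_image.1 hxy
  have hy0 : y ≠ 0 := fun h => h0 _ (h ▸ hy)
  refine hS (Fin.snoc (α := fun _ => F) (Fin.snoc (α := fun _ => F) (fun i : Fin v => g i.castSucc.castSucc) x) y) ?_ ?_
  · intro i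
    refine Fin.lastCases ?_ (fun i => ?_) i
    · simpa using hy
    · refine Fin.lastCases ?_ (fun i => ?_) i
      · simpa using hx
      · simpa using hg _
  · rw [Fin.prod_univ_castSucc, Fin.prod_univ_castSucc]
    simp only [Fin.snoc_castSucc, Fin.snoc_last]
    rw [← hr, ← hyx, mul_assoc, div_mul_cancel₀ _ hy0, ht, mul_div_cancel₀ _ hr0]

theorem part_two {F : Type} [Field F] [Fintype F] (w d : ℕ) (hd : 2 ≤ d)
    (hF : Fintype.card F = 6 * d + 2) (h5 : ¬ 5 ∣ 6 * d + 1)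
    (hb : ∀ d' : ℕ, 0 < d' → d' ∣ 6 * d + 1 → d' < d →
      ((w : ℝ) + 1) ≥ ((6 * (d : ℝ) + 1) / (d' : ℝ) - (⌈(2 * (d : ℝ)) / (d' : ℝ)⌉ : ℝ))
          / ((⌈(d : ℝ) / (d' : ℝ)⌉ : ℝ) - 1) + 1) :
    ¬ Realizable F (w + 1) (fun i => if (i : ℕ) = w + 1 - 1 then 2 * d else d) := by
  classical
  rintro ⟨S, h0, hc, hS⟩
  have hG : Nat.card Fˣ = 6 * d + 1 := by
    rw [Nat.card_eq_fintype_card, Fintype.card_units, hF]; omega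
  have hcov := prod_cover (G := Fˣ) w d hd hG h5 (fun i => Units.val ⁻¹' (S i : Set F)) (by
    intro i
    have := hc i
    simp only [Nat.add_sub_cancel] at this
    rw [← this, ← Set.ncard_coe_finset]
    apply Set.ncard_preimage_of_injective_subset_range Units.val_injective
    intro x hx
    have : x ≠ 0 := fun h => h0 i (h ▸ hx)
    exact ⟨Units.mk0 x this, rfl⟩) hb
  have hmem : ((-1 : Fˣ) ^ (w + 1 - 1)) ∈ ∏ i, (fun i => Units.val ⁻¹' (S i : Set F)) i := by
    rw [hcov]; trivial
  rw [Set.mem_finsetProd] at hmem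
  obtain ⟨g, hg, hgp⟩ := hmem
  refine hS (fun i => (g i : F)) (fun i => hg (Finset.mem_univ i)) ?_
  have := congrArg Units.val hgp
  push_cast at this
  exact this.symm

end Aux

theorem realizable_char_two_gap
    (k : ℕ) (hk : 2 ≤ k) (q d : ℕ) (hq : q = 2 ^ (2 * k)) (hd : d = (2 ^ (2 * k) - 1) / 3)
    (ω : ℕ) (hω : 3 ≤ ω)
    (hωbound : ∀ d' : ℕ, 0 < d' → d' ∣ 2 ^ (2 * k + 1) - 1 → d' < d →
      (ω : ℝ) ≥ (((2 : ℝ) ^ (2 * k + 1) - 1) / (d' : ℝ)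
            - (⌈((q : ℝ) - (d : ℝ) - 1) / (d' : ℝ)⌉ : ℝ))
          / ((⌈(d : ℝ) / (d' : ℝ)⌉ : ℝ) - 1) + 1) :
    (∀ (F : Type) [Field F] [Fintype F], Fintype.card F = 2 ^ (2 * k) →
      Realizable F ω (fun i => if (i : ℕ) = ω - 1 then 2 * d else d)) ∧
    (∀ (F' : Type) [Field F'] [Fintype F'], Fintype.card F' = 2 ^ (2 * k + 1) →
      ¬ Realizable F' ω (fun i => if (i : ℕ) = ω - 1 then 2 * d else d)) ∧
    (∀ (F'' : Type) [Field F''] [Fintype F''], Fintype.card F'' < 2 ^ (2 * k) →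
      ¬ Realizable F'' ω (fun i => if (i : ℕ) = ω - 1 then 2 * d else d)) := by
  have h3 : 3 * d + 1 = 2 ^ (2 * k) := by
    have h1 : 2 ^ (2 * k) % 3 = 1 := by
      rw [pow_mul, Nat.pow_mod]; norm_num
    omega
  have h6 : 2 ^ (2 * k + 1) = 6 * d + 2 := by rw [pow_succ, ← h3]; ring
  have hd2 : 2 ≤ d := by
    have : 2 ^ (2 * 2) ≤ 2 ^ (2 * k) := Nat.pow_le_pow_right (by norm_num) (by omega)
    norm_num at this
    omega
  have h5 : ¬ 5 ∣ 6 * d + 1 := by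
    have h1 : 2 ^ (2 * k) % 5 = 1 ∨ 2 ^ (2 * k) % 5 = 4 := by
      rw [pow_mul]
      clear * -
      induction k with
      | zero => simp
      | succ n ih => rw [pow_succ]; omega
    omega
  obtain ⟨w, rfl⟩ : ∃ w, ω = w + 1 := ⟨ω - 1, by omega⟩
  refine ⟨?_, ?_, ?_⟩
  · intro F _ _ hF
    exact part_one k d w (hF.trans h3.symm) h3
  · intro F _ _ hF
    refine part_two w d hd2 (hF.trans h6) h5 ?_
    intro d' hd' hdvd hlt
    have hb := hωbound d' hd' (by rw [h6]; exact hdvd) hlt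
    have e1 : (2 : ℝ) ^ (2 * k + 1) - 1 = 6 * (d : ℝ) + 1 := by
      have : ((2 ^ (2 * k + 1) : ℕ) : ℝ) = ((6 * d + 2 : ℕ) : ℝ) := by rw [h6]
      push_cast at this
      linarith
    have e2 : (q : ℝ) - (d : ℝ) - 1 = 2 * (d : ℝ) := by
      have : (q : ℝ) = ((3 * d + 1 : ℕ) : ℝ) := by rw [hq, h3]
      push_cast at this
      linarith
    rw [e1, e2] at hb
    push_cast at hb
    exact hb
  · intro F _ _ hF
    exact part_three d w (by omega) (by omega) (by rw [h3]; exact hF)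
end

section
/- Let p and p' be two distinct prime numbers. Then for every positive integer N there exist integers k, k' ≥ N with p^k < p'^{k'}, an integer ω ≥ 3, and a tuple (d_1, …, d_ω) of integers each at least 2, such that (d_1, …, d_ω) is realizable over the field of order p^k, is not realizable over any finite field of order less than p^k, and is NOT realizable over the field of order p'^{k'}. In particular, there are infinitely many pairs (k, k') for which some multicast network is linearly solvable over GF(p^k) with q_min = p^k but not linearly solvable over GF(p'^{k'}), even though p^k < p'^{k'}. -/
open Pointwise in
theorem stag {G : Type*} [CommGroup G] [Fintype G] [DecidableEq G] (E B : Finset G)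
    (hB : B.Nonempty) (h : (E * B).card = E.card) (t : G) (ht : t ∉ E) :
    ∃ h' : ℕ, h' ∣ Fintype.card G ∧ B.card ≤ h' ∧ E.card + h' ≤ Fintype.card G := by
  classical
  obtain ⟨b0, hb0⟩ := hB
  have key : ∀ b ∈ B, b • E = E * B := by
    intro b hb
    apply Finset.eq_of_subset_of_card_le
    · intro x hx
      obtain ⟨y, hy, rfl⟩ := Finset.mem_smul_finset.1 hx
      rw [smul_eq_mul, mul_comm b y]
      exact Finset.mul_mem_mul hy hb
    · rw [h, Finset.card_smul_finset]
  let H : Subgroup G := MulAction.stabilizer G E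
  let HF : Finset G := Finset.univ.filter (· ∈ H)
  have hHF : HF.card = Nat.card H := by
    rw [Nat.card_eq_fintype_card, Fintype.card_subtype]
  refine ⟨HF.card, ?_, ?_, ?_⟩
  · rw [hHF, ← Nat.card_eq_fintype_card]; exact Subgroup.card_subgroup_dvd_card H
  · apply Finset.card_le_card_of_injOn (fun b => b0⁻¹ * b)
    · intro b hb
      simp only [HF, Finset.coe_filter, Finset.mem_univ, true_and, Set.mem_ofPred_eq, H,
        MulAction.mem_stabilizer_iff]
      rw [mul_smul, key b hb, ← key b0 hb0, inv_smul_smul]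
    · intro a _ b _ hab
      simpa using hab
  · have hd : Disjoint E (t • HF) := by
      rw [Finset.disjoint_left]
      intro x hx hx'
      obtain ⟨y, hy, rfl⟩ := Finset.mem_smul_finset.1 hx'
      simp only [HF, Finset.mem_filter, Finset.mem_univ, true_and] at hy
      have h2 : y⁻¹ • E = E := H.inv_mem hy
      apply ht
      rw [← h2]
      refine Finset.mem_smul_finset.2 ⟨_, hx, ?_⟩
      simp [mul_comm]
    rw [← Finset.card_smul_finset t HF, ← Finset.card_union_of_disjoint hd]
    exact Finset.card_le_univ _

open Pointwise in
theorem grow {G : Type*} [CommGroup G] [Fintype G] (h : ℕ) (hh : 0 < h) (t : G) :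
    ∀ (M : ℕ) (A : Fin M → Finset G) (E : Finset G), (∀ i, (A i).card = h) →
      Fintype.card G ≤ E.card + M →
      (∀ e ∈ E, ∀ a : Fin M → G, (∀ i, a i ∈ A i) → t ≠ e * ∏ i, a i) →
      ∃ h' : ℕ, h' ∣ Fintype.card G ∧ h ≤ h' ∧ E.card + h' ≤ Fintype.card G := by
  classical
  intro M
  induction M with
  | zero =>
    intro A E hA hc ht
    have : E = Finset.univ := (Finset.card_eq_iff_eq_univ E).1
      (le_antisymm (Finset.card_le_univ _) (by simpa using hc))
    exact absurd (by simp) (ht t (by simp [this]) Fin.elim0 (fun i => i.elim0))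
  | succ M ih =>
    intro A E hA hc ht
    have hne : ∀ i, (A i).Nonempty := fun i => Finset.card_pos.1 (by rw [hA]; exact hh)
    have hle : E.card ≤ (E * A 0).card := Finset.card_le_card_mul_right (hne 0)
    rcases hle.eq_or_lt with heq | hlt
    · choose a ha using hne
      obtain ⟨h', h1, h2, h3⟩ := stag E (A 0) ⟨_, ha 0⟩ heq.symm (t * (∏ i, a i)⁻¹)
        (fun hm => ht _ hm a ha (by simp))
      exact ⟨h', h1, by rwa [hA] at h2, h3⟩
    · obtain ⟨h', h1, h2, h3⟩ := ih (fun i => A i.succ) (E * A 0) (fun i => hA _) (by omega)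
        (by
          intro e he a ha
          obtain ⟨x, hx, y, hy, rfl⟩ := Finset.mem_mul.1 he
          have := ht x hx (Fin.cons y a) (by
            intro i
            refine Fin.cases ?_ (fun j => ?_) i
            · simpa using hy
            · simpa using ha j)
          simpa [Fin.prod_univ_succ, mul_assoc] using this)
      exact ⟨h', h1, h2, by omega⟩

theorem nonreal (F : Type) [Field F] [Fintype F] (M h e : ℕ) (hh : 0 < h)
    (hM : Fintype.card F ≤ M) (hr : Realizable F (M + 1) (Fin.cons e (fun _ => h))) :
    ∃ h' : ℕ, h' ∣ Fintype.card F - 1 ∧ h ≤ h' ∧ e + h' ≤ Fintype.card F - 1 := by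
  classical
  obtain ⟨S, h0, hc, hS⟩ := hr
  let S' : Fin (M + 1) → Finset Fˣ := fun i => Finset.univ.filter (fun u => (u : F) ∈ S i)
  have hc' : ∀ i, (S' i).card = (S i).card := by
    intro i
    apply Finset.card_bij (fun (u : Fˣ) _ => (u : F))
    · intro u hu; simpa [S'] using hu
    · intro u _ v _ huv; exact Units.ext huv
    · intro x hx
      have hx0 : x ≠ 0 := fun h => h0 i (h ▸ hx)
      exact ⟨Units.mk0 x hx0, by simpa [S'] using hx, rfl⟩
  have hcard : Fintype.card Fˣ = Fintype.card F - 1 := Fintype.card_units F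
  have := grow (G := Fˣ) h hh ((-1) ^ M) M (fun i => S' i.succ) (S' 0)
    (fun i => by rw [hc', hc]; simp) (by omega) (by
      intro x hx a ha heq
      refine hS (fun i => ((Fin.cons x a : Fin (M + 1) → Fˣ) i : F)) ?_ ?_
      · intro i
        refine Fin.cases ?_ (fun j => ?_) i
        · simpa [S'] using hx
        · simpa [S'] using ha j
      · have := congrArg (fun u : Fˣ => (u : F)) heq
        simpa [Fin.prod_univ_succ] using this)
  rw [hc', hc, hcard] at this
  simpa using this

open Pointwise in
theorem real (F : Type) [Field F] [Fintype F] (M h r : ℕ) (hr : 0 < r)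
    (hn : Fintype.card F - 1 = h * r) :
    Realizable F (M + 1) (Fin.cons (h * (r - 1)) (fun _ => h)) := by
  classical
  have hcard : Fintype.card Fˣ = h * r := by rw [← hn]; exact Fintype.card_units F
  obtain ⟨g, hg⟩ := IsCyclic.exists_ofOrder_eq_natCard (α := Fˣ)
  rw [Nat.card_eq_fintype_card, hcard] at hg
  let H : Subgroup Fˣ := Subgroup.zpowers (g ^ r)
  have hH : Nat.card H = h := by
    rw [Nat.card_zpowers, orderOf_pow_of_dvd hr.ne' (by rw [hg]; exact dvd_mul_left _ _), hg,
      Nat.mul_div_cancel _ hr]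
  let HF : Finset Fˣ := Finset.univ.filter (· ∈ H)
  have hHF : HF.card = h := by
    rw [← hH, Nat.card_eq_fintype_card, Fintype.card_subtype]
  let t : Fˣ := (-1) ^ M
  let E : Finset Fˣ := (t • HF)ᶜ
  have hE : E.card = h * (r - 1) := by
    rw [Finset.card_compl, Finset.card_smul_finset, hHF, hcard, Nat.mul_sub, mul_one]
  let S' : Fin (M + 1) → Finset Fˣ := Fin.cons E (fun _ => HF)
  refine ⟨fun i => (S' i).map ⟨Units.val, Units.val_injective⟩, ?_, ?_, ?_⟩
  · intro i; simp
  · intro i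
    rw [Finset.card_map]
    refine Fin.cases ?_ (fun j => ?_) i
    · simpa [S'] using hE
    · simpa [S'] using hHF
  · intro a ha heq
    choose u hu hua using fun i => Finset.mem_map.1 (ha i)
    have h1 : t = ∏ i, u i := by
      apply Units.ext
      simp only [Function.Embedding.coeFn_mk] at hua
      simpa [t, Units.coe_prod, hua] using heq
    rw [Fin.prod_univ_succ] at h1
    have h2 : ∏ i : Fin M, u i.succ ∈ H := Subgroup.prod_mem _ (fun i _ => by
      have := hu i.succ
      simpa [S', HF] using this)
    have h3 : u 0 ∈ E := hu 0
    apply Finset.mem_compl.1 h3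
    refine Finset.mem_smul_finset.2 ⟨(∏ i : Fin M, u i.succ)⁻¹, ?_, ?_⟩
    · simpa [HF] using h2
    · simp [h1]

open Filter Topology in
theorem approx (A L ε : ℝ) (hL : 0 < L) (hi : Irrational (A / L)) (hε : 0 < ε) (N : ℕ) :
    ∃ n : ℕ, N ≤ n ∧ ∃ z : ℤ, 0 < z * L - n * A ∧ z * L - n * A < ε := by
  have : Fact (0 < L) := ⟨hL⟩
  have hd := (AddCircle.denseRange_zsmul_coe_iff (a := A) (p := L)).2 hi
  have hcl : MapClusterPt ((-(ε/2) : ℝ) : AddCircle L) atTop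
      (fun n : ℕ => n • (A : AddCircle L)) :=
    ((mapClusterPt_atTop_nsmul_tfae _ _).out 0 3).2 (hd _)
  have hopen : IsOpen ((fun x : ℝ => (x : AddCircle L)) '' Set.Ioo (-ε) 0) :=
    QuotientAddGroup.isOpenMap_coe _ isOpen_Ioo
  have hmem := hopen.mem_nhds (x := ((-(ε/2) : ℝ) : AddCircle L))
    ⟨-(ε/2), ⟨by linarith, by linarith⟩, rfl⟩
  have hf := (mapClusterPt_iff_frequently.1 hcl) _ hmem
  obtain ⟨n, hn, x, hx, hxe⟩ := (frequently_atTop.1 hf) N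
  refine ⟨n, hn, ?_⟩
  have : ((n * A - x : ℝ) : AddCircle L) = 0 := by
    have h1 : (x : AddCircle L) = ((n • A : ℝ) : AddCircle L) := by simpa using hxe
    rw [AddCircle.coe_sub, h1, nsmul_eq_mul, sub_self]
  obtain ⟨z, hz⟩ := (AddCircle.coe_eq_zero_iff L).1 this
  refine ⟨z, ?_⟩
  rw [zsmul_eq_mul] at hz
  rw [hz]
  constructor <;> [linarith [hx.2]; linarith [hx.1]]

theorem irr (p p' m : ℕ) (hp : p.Prime) (hp' : p'.Prime) (hne : p ≠ p') (hm : 0 < m) :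
    Irrational (m * Real.log p / Real.log p') := by
  have h1 : 0 < Real.log p := Real.log_pos (by exact_mod_cast hp.one_lt)
  have h2 : 0 < Real.log p' := Real.log_pos (by exact_mod_cast hp'.one_lt)
  rintro ⟨q, hq⟩
  have hqpos : (0:ℝ) < q := by rw [hq]; positivity
  have hq0 : 0 < q := by exact_mod_cast hqpos
  obtain ⟨u, hu⟩ := Int.eq_ofNat_of_zero_le (Rat.num_pos.2 hq0).le
  have hqd : (q : ℝ) = u / q.den := by
    conv_lhs => rw [Rat.cast_def, hu]
    simp
  have hden : (q.den : ℝ) ≠ 0 := by exact_mod_cast q.den_nz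
  have h3 : ((m * q.den : ℕ) : ℝ) * Real.log p = u * Real.log p' := by
    rw [hqd] at hq
    field_simp at hq
    push_cast
    linarith
  rw [← Real.log_pow, ← Real.log_pow] at h3
  have h4 := Real.log_injOn_pos (Set.mem_Ioi.2 (by have := hp.pos; positivity))
    (Set.mem_Ioi.2 (by have := hp'.pos; positivity)) h3
  have h5 : p ^ (m * q.den) = p' ^ u := by exact_mod_cast h4
  have h6 : p ∣ p' ^ u := h5 ▸ dvd_pow_self p (Nat.mul_pos hm q.den_pos).ne'
  exact hne ((Nat.prime_dvd_prime_iff_eq hp hp').1 (hp.dvd_of_dvd_pow h6))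

theorem dioph (p p' m : ℕ) (hp : p.Prime) (hp' : p'.Prime) (hne : p ≠ p') (hm : 0 < m)
    (C N : ℕ) : ∃ n k' : ℕ, N ≤ n ∧ N ≤ k' ∧ p ^ (m * n) < p' ^ k' ∧
      C * (p' ^ k' - p ^ (m * n)) < p ^ (m * n) := by
  have h1 : 0 < Real.log p := Real.log_pos (by exact_mod_cast hp.one_lt)
  have h2 : 0 < Real.log p' := Real.log_pos (by exact_mod_cast hp'.one_lt)
  have hε : 0 < Real.log (1 + 1 / (C + 1)) := Real.log_pos (by
    have : (0:ℝ) < 1 / (C + 1) := by positivity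
    linarith)
  obtain ⟨n, hn, z, hz1, hz2⟩ := approx (m * Real.log p) (Real.log p') _ h2
    (irr p p' m hp hp' hne hm) hε (N + p' ^ N)
  have hzpos : 0 < z := by
    have : 0 < (z : ℝ) * Real.log p' := by
      have : 0 ≤ (n : ℝ) * (m * Real.log p) := by positivity
      linarith
    exact_mod_cast pos_of_mul_pos_left this h2.le
  obtain ⟨k', rfl⟩ := Int.eq_ofNat_of_zero_le hzpos.le
  have hpp : (0:ℝ) < (p:ℝ) ^ (m * n) := by have := hp.pos; positivity
  have hpp' : (0:ℝ) < (p':ℝ) ^ k' := by have := hp'.pos; positivity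
  have e1 : (((k' : ℕ) : ℤ) : ℝ) * Real.log p' = Real.log ((p':ℝ) ^ k') := by
    rw [Real.log_pow]; simp
  have e2 : (n : ℝ) * (m * Real.log p) = Real.log ((p:ℝ) ^ (m * n)) := by
    rw [Real.log_pow]; push_cast; ring
  have hz1' : Real.log ((p:ℝ) ^ (m * n)) < Real.log ((p':ℝ) ^ k') := by
    rw [← e1, ← e2]; linarith
  have hlt := (Real.log_lt_log_iff hpp hpp').1 hz1'
  have hz2' : Real.log ((p':ℝ) ^ k') < Real.log ((p:ℝ) ^ (m * n) * (1 + 1 / (C + 1))) := by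
    rw [Real.log_mul hpp.ne' (by positivity), ← e1, ← e2]; linarith
  have hlt2 := (Real.log_lt_log_iff hpp' (by positivity)).1 hz2'
  have hltN : p ^ (m * n) < p' ^ k' := by exact_mod_cast hlt
  refine ⟨n, k', by omega, ?_, hltN, ?_⟩
  · by_contra hcon
    have a1 : p' ^ k' ≤ p' ^ N := Nat.pow_le_pow_right hp'.pos (by omega)
    have a2 : m * n < p ^ (m * n) := Nat.lt_pow_self hp.one_lt
    have a3 : n ≤ m * n := Nat.le_mul_of_pos_left _ hm
    omega
  · have : (C:ℝ) * ((p':ℝ) ^ k' - (p:ℝ) ^ (m * n)) < (p:ℝ) ^ (m * n) := by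
      have hC : (0:ℝ) < C + 1 := by positivity
      have h5 : ((C:ℝ) + 1) * ((p':ℝ) ^ k' - (p:ℝ) ^ (m * n)) < (p:ℝ) ^ (m * n) := by
        have : ((C:ℝ) + 1) * ((p:ℝ) ^ (m * n) * (1 + 1 / (C + 1)))
          = (C + 1) * (p:ℝ) ^ (m * n) + (p:ℝ) ^ (m * n) := by field_simp
        have := mul_lt_mul_of_pos_left hlt2 hC
        linarith
      linarith
    zify [hltN.le]
    exact_mod_cast this

theorem arith (n n' h h' r : ℕ) (hr : 2 ≤ r) (hn : n = h * r) (hh : 0 < h) (hnn : n ≤ n')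
    (hδ : r * (n' - n) ≤ h) (h1 : h' ∣ n') (h2 : h ≤ h') (h3 : h * (r - 1) + h' ≤ n') :
    r ∣ n' := by
  obtain ⟨s, hs⟩ := h1
  obtain ⟨δ, rfl⟩ := Nat.exists_eq_add_of_le hnn
  obtain ⟨c, rfl⟩ := Nat.exists_eq_add_of_le hr
  have e : 2 + c - 1 = c + 1 := by omega
  rw [e] at h3
  simp only [Nat.add_sub_cancel_left] at hδ
  subst hn
  have h3' : h' ≤ h + δ := by nlinarith
  have hs1 : s < 2 + c + 1 := by
    by_contra hcon
    push Not at hcon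
    have : h * (2 + c + 1) ≤ h' * s := Nat.mul_le_mul h2 hcon
    nlinarith
  have hs2 : 2 + c - 1 < s := by
    by_contra hcon
    push Not at hcon
    have : h' * s ≤ (h + δ) * (c + 1) := Nat.mul_le_mul h3' (by omega)
    nlinarith
  have : s = 2 + c := by omega
  rw [hs, this]; exact dvd_mul_left _ _

theorem distinct_characteristics_qmin_lt
    (p p' : ℕ) (hp : p.Prime) (hp' : p'.Prime) (hne : p ≠ p') :
    ∀ N : ℕ, 0 < N → ∃ k k' : ℕ, N ≤ k ∧ N ≤ k' ∧ p ^ k < p' ^ k' ∧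
      ∃ ω : ℕ, 3 ≤ ω ∧ ∃ d : Fin ω → ℕ, (∀ i, 2 ≤ d i) ∧
        (∀ (F : Type) [Field F] [Fintype F], Fintype.card F = p ^ k →
          Realizable F ω d) ∧
        (∀ (F : Type) [Field F] [Fintype F], Fintype.card F < p ^ k →
          ¬ Realizable F ω d) ∧
        (∀ (F' : Type) [Field F'] [Fintype F'], Fintype.card F' = p' ^ k' →
          ¬ Realizable F' ω d) := by
  intro N hN
  have hr := hp'.two_le
  have hm : 0 < p' - 1 := by omega
  obtain ⟨n, k', hn, hk', hlt, hC⟩ := dioph p p' (p' - 1) hp hp' hne hm (p' * p') (N + 2 * p')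
  obtain ⟨k, hk⟩ : ∃ k, k = (p' - 1) * n := ⟨_, rfl⟩
  rw [← hk] at hlt hC
  have hnk : n ≤ k := hk ▸ Nat.le_mul_of_pos_left _ hm
  have hkk : k < p ^ k := Nat.lt_pow_self hp.one_lt
  have hdvd : p' ∣ p ^ k - 1 := by
    have hcop : Nat.Coprime p p' := (Nat.coprime_primes hp hp').2 hne
    have := Nat.ModEq.pow_totient hcop
    rw [Nat.totient_prime hp'] at this
    have h2 := this.pow n
    rw [← pow_mul, ← hk, one_pow] at h2
    exact (Nat.modEq_iff_dvd' (by omega)).1 h2.symm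
  obtain ⟨h, hh⟩ := hdvd
  rw [mul_comm] at hh
  have hh2 : 2 ≤ h := by
    by_contra hcon
    have : h * p' ≤ 1 * p' := Nat.mul_le_mul_right _ (by omega)
    omega
  have hM : 2 * p' ≤ p' ^ k' := by omega
  refine ⟨k, k', by omega, by omega, hlt, p' ^ k' + 1, by omega,
    Fin.cons (h * (p' - 1)) (fun _ => h), ?_, ?_, ?_, ?_⟩
  · intro i
    refine Fin.cases ?_ (fun j => ?_) i
    · simpa using hh2.trans (Nat.le_mul_of_pos_right h hm)
    · simpa using hh2
  · intro F _ _ hF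
    exact real F _ h p' hp'.pos (by rw [hF, hh])
  · intro F _ _ hF hR
    obtain ⟨h', -, h2, h3⟩ := nonreal F (p' ^ k') h (h * (p' - 1)) (by omega) (by omega) hR
    have : h * (p' - 1) + h = h * p' := by
      rw [← Nat.mul_succ]; congr 1; omega
    have := Fintype.card_pos (α := F)
    omega
  · intro F _ _ hF hR
    obtain ⟨h', h1, h2, h3⟩ := nonreal F (p' ^ k') h (h * (p' - 1)) (by omega) (by omega) hR
    rw [hF] at h1 h3
    have hd : p' ∣ p' ^ k' - 1 := by
      refine arith (p ^ k - 1) _ h h' p' hr hh (by omega) (by omega) ?_ h1 h2 h3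
      have e : p' ^ k' - 1 - (p ^ k - 1) = p' ^ k' - p ^ k := by omega
      rw [e]
      have : p' * (p' * (p' ^ k' - p ^ k)) ≤ p' * h := by
        rw [← mul_assoc, mul_comm p' h]; omega
      exact Nat.le_of_mul_le_mul_left this hp'.pos
    have hd2 : p' ∣ p' ^ k' := dvd_pow_self _ (by omega)
    have := (Nat.dvd_sub hd2 hd)
    have e : p' ^ k' - (p' ^ k' - 1) = 1 := by omega
    rw [e] at this
    exact hp'.one_lt.ne' (Nat.dvd_one.1 this)
end

section
/- Let p be an odd prime, let k ≤ k' be positive integers, let ω ≥ 3 be an integer, and let d_1, …, d_ω be integers each at least 2. If the tuple (d_1, …, d_ω) is realizable over the field GF(p^k) of order p^k, then it is also realizable over the field GF(p^{k'}) of order p^{k'}. -/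
open Classical in
lemma chi_card_le (F : Type) [Field F] [Fintype F] (hc : ringChar F ≠ 2) (e : ℤ)
    (he : e = 1 ∨ e = -1) :
    Fintype.card F ≤ 2 * (Finset.univ.filter (fun x : F => quadraticChar F x = e)).card + 1 := by
  obtain ⟨b, hb⟩ := quadraticChar_exists_neg_one hc
  have hb0 : b ≠ 0 := by
    rintro rfl
    simp at hb
  have hle : (Finset.univ.filter (fun x : F => quadraticChar F x = -e)).card ≤
      (Finset.univ.filter (fun x : F => quadraticChar F x = e)).card := by
    apply Finset.card_le_card_of_injOn (fun x => b * x)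
    · intro x hx
      simp only [Finset.coe_filter, Finset.mem_univ, true_and, Set.mem_ofPred_eq] at hx ⊢
      rw [map_mul, hb, hx]
      ring
    · intro x _ y _ hxy
      exact mul_left_cancel₀ hb0 hxy
  have hsub : (Finset.univ : Finset F) ⊆
      ((Finset.univ.filter (fun x : F => quadraticChar F x = e)) ∪
      (Finset.univ.filter (fun x : F => quadraticChar F x = -e))) ∪ {0} := by
    intro x _
    by_cases hx : x = 0
    · simp [hx]
    · rcases quadraticChar_dichotomy hx with h | h <;> rcases he with rfl | rfl <;>
        simp only [Finset.mem_union, Finset.mem_filter, Finset.mem_univ, true_and, h] <;> simp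
  have h1 := Finset.card_le_card hsub
  have h2 := Finset.card_union_le ((Finset.univ.filter (fun x : F => quadraticChar F x = e)) ∪
      (Finset.univ.filter (fun x : F => quadraticChar F x = -e))) {0}
  have h3 := Finset.card_union_le (Finset.univ.filter (fun x : F => quadraticChar F x = e))
      (Finset.univ.filter (fun x : F => quadraticChar F x = -e))
  rw [Finset.card_univ] at h1
  rw [Finset.card_singleton] at h2
  omega

lemma realizable_of_equiv (F F' : Type) [Field F] [Field F'] (e : F ≃+* F') (ω : ℕ)
    (d : Fin ω → ℕ) (h : Realizable F ω d) : Realizable F' ω d := by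
  obtain ⟨S, h0, hcard, hS⟩ := h
  refine ⟨fun i => (S i).map e.toEquiv.toEmbedding, ?_, ?_, ?_⟩
  · intro i hi
    simp at hi
    exact h0 i hi
  · intro i
    simp [hcard]
  · intro a ha hprod
    apply hS (fun i => e.symm (a i))
    · intro i
      have := ha i
      simp only [Finset.mem_map] at this
      obtain ⟨x, hx, hxa⟩ := this
      rw [← hxa]
      simpa using hx
    · rw [← map_prod, ← hprod]
      simp

open Classical in
lemma realizable_of_le (F : Type) [Field F] [Fintype F] (hc : ringChar F ≠ 2) (ω : ℕ)
    (hω : 0 < ω) (d : Fin ω → ℕ) (hd : ∀ i, 2 * d i + 1 ≤ Fintype.card F) :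
    Realizable F ω d := by
  have hcne : ((-1 : F) ^ (ω - 1)) ≠ 0 := by simp
  let ε : Fin ω → ℤ := fun i => if i = ⟨0, hω⟩ then - quadraticChar F ((-1 : F) ^ (ω - 1)) else 1
  have hε : ∀ i, ε i = 1 ∨ ε i = -1 := by
    intro i
    by_cases hi : i = ⟨0, hω⟩
    · rcases quadraticChar_dichotomy hcne with h | h <;> simp only [ε, hi, if_true, h] <;> simp
    · simp [ε, hi]
  have hex : ∀ i, ∃ T : Finset F,
      T ⊆ (Finset.univ.filter (fun x : F => quadraticChar F x = ε i)) ∧ T.card = d i := by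
    intro i
    apply Finset.exists_subset_card_eq
    have := chi_card_le F hc (ε i) (hε i)
    have := hd i
    omega
  choose T hT hTc using hex
  have hchi : ∀ i, ∀ x ∈ T i, quadraticChar F x = ε i := fun i x hx => by
    simpa using hT i hx
  refine ⟨T, ?_, hTc, ?_⟩
  · intro i hi
    have := hchi i 0 hi
    rw [quadraticChar_zero] at this
    rcases hε i with h | h <;> omega
  · intro a ha hprod
    have h1 : quadraticChar F ((-1 : F) ^ (ω - 1)) = ∏ i, ε i := by
      rw [hprod, map_prod]
      exact Finset.prod_congr rfl (fun i _ => hchi i _ (ha i))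
    have h2 : ∏ i, ε i = - quadraticChar F ((-1 : F) ^ (ω - 1)) := by
      simp only [ε]
      rw [Finset.prod_ite_eq' Finset.univ (⟨0, hω⟩ : Fin ω)
        (fun _ => - quadraticChar F ((-1 : F) ^ (ω - 1)))]
      simp
    rw [h2] at h1
    rcases quadraticChar_dichotomy hcne with h | h <;> omega

theorem realizable_monotone_odd_char
    (p : ℕ) (hp : p.Prime) (hodd : Odd p) (k k' : ℕ) (hk : 0 < k) (hkk' : k ≤ k')
    (ω : ℕ) (hω : 3 ≤ ω) (d : Fin ω → ℕ) (hd : ∀ i, 2 ≤ d i)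
    (F F' : Type) [Field F] [Fintype F] [Field F'] [Fintype F']
    (hF : Fintype.card F = p ^ k) (hF' : Fintype.card F' = p ^ k')
    (h : Realizable F ω d) : Realizable F' ω d := by
  rcases hkk'.eq_or_lt with rfl | hlt
  · exact realizable_of_equiv F F' (FiniteField.ringEquivOfCardEq (hF.trans hF'.symm)) ω d h
  · have hc : ringChar F' ≠ 2 := by
      intro h2
      have h3 := FiniteField.even_card_of_char_two h2
      rw [hF'] at h3
      have h4 : Odd (p ^ k') := hodd.pow
      rw [Nat.odd_iff] at h4
      omega
    apply realizable_of_le F' hc ω (by omega) d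
    intro i
    obtain ⟨S, h0, hcard, -⟩ := h
    have h1 : (S i).card < Fintype.card F := by
      rw [← Finset.card_univ]
      apply Finset.card_lt_card
      rw [Finset.ssubset_univ_iff]
      intro hu
      exact h0 i (hu ▸ Finset.mem_univ _)
    rw [hcard, hF] at h1
    rw [hF']
    have h5 : p ^ (k + 1) ≤ p ^ k' := Nat.pow_le_pow_right hp.pos hlt
    have h6 : 2 * p ^ k ≤ p ^ (k + 1) := by
      rw [pow_succ, mul_comm]
      exact Nat.mul_le_mul_left _ hp.two_le
    omega
end

section
/- Let q ≥ 5 be an integer and let F be a finite field of order q_0. Then there exist elements a_1, a_2 ∈ F \ {0} and pairwise distinct elements δ_1, δ_2, …, δ_{q−2} ∈ F \ {0} such that 1 ∉ {α · δ_k : α ∈ {1, a_1, a_2, a_1 a_2}, 1 ≤ k ≤ q − 2}, if and only if q_0 ≥ q. -/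
theorem network_Nq_solvable_iff
    (q : ℕ) (hq : 5 ≤ q) (F : Type) [Field F] [Fintype F]
    (q₀ : ℕ) (hF : Fintype.card F = q₀) :
    (∃ (a₁ a₂ : F) (δ : Fin (q - 2) → F),
        a₁ ≠ 0 ∧ a₂ ≠ 0 ∧ (∀ i, δ i ≠ 0) ∧ Function.Injective δ ∧
        ∀ i : Fin (q - 2), ∀ α ∈ ({1, a₁, a₂, a₁ * a₂} : Set F), α * δ i ≠ 1) ↔
      q ≤ q₀ := by
  classical
  obtain ⟨S, hS, hc⟩ : ∃ S : Finset F, (∀ x, x ∈ S ↔ x ≠ 0 ∧ x ≠ 1) ∧ S.card = q₀ - 2 := by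
    refine ⟨({0, 1} : Finset F)ᶜ, fun x => by simp, ?_⟩
    rw [Finset.card_compl, hF, Finset.card_pair zero_ne_one]
  constructor
  · rintro ⟨a₁, a₂, δ, -, -, h0, hinj, h1⟩
    have hm : ∀ i, δ i ∈ S := by
      intro i
      have h := h1 i 1 (by simp)
      rw [one_mul] at h
      exact (hS _).2 ⟨h0 i, h⟩
    have := Fintype.card_le_of_injective
      (fun i => (⟨δ i, hm i⟩ : {x : F // x ∈ S}))
      (fun i j hij => hinj (congrArg Subtype.val hij))
    rw [Fintype.card_coe, hc, Fintype.card_fin] at this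
    omega
  · intro h
    obtain ⟨e⟩ : Nonempty (Fin (q - 2) ↪ {x : F // x ∈ S}) := by
      apply Function.Embedding.nonempty_of_card_le
      rw [Fintype.card_coe, hc, Fintype.card_fin]
      omega
    have he : ∀ i, (e i : F) ≠ 0 ∧ (e i : F) ≠ 1 := by
      intro i
      exact (hS _).1 (e i).2
    refine ⟨1, 1, fun i => (e i : F), one_ne_zero, one_ne_zero, fun i => (he i).1,
      fun i j hij => e.injective (Subtype.ext hij), ?_⟩
    intro i α hα
    have : α = 1 := by simpa using hα
    rw [this, one_mul]
    exact (he i).2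
end

section
/- Let q be a prime power such that q − 1 is composite (i.e., q is not equal to a prime plus 1), and let d be a divisor of q − 1 with 1 < d < q − 1. Then the triple (d, d, q − d − 1) is realizable over the field GF(q) of order q, and is NOT realizable over any finite field of order less than q; that is, q is the minimum field size over which (d, d, q − d − 1) is realizable. -/
theorem prescribed_qmin (q : ℕ) (hq : IsPrimePow q)
    (hcomp : 1 < q - 1 ∧ ¬ (q - 1).Prime)
    (d : ℕ) (hdvd : d ∣ q - 1) (hd1 : 1 < d) (hd2 : d < q - 1) :
    (∀ (F : Type) [Field F] [Fintype F], Fintype.card F = q →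
      Realizable F 3 ![d, d, q - d - 1]) ∧
    (∀ (F : Type) [Field F] [Fintype F], Fintype.card F < q →
      ¬ Realizable F 3 ![d, d, q - d - 1]) := by
  classical
  constructor
  · intro F _ _ hF
    have hcard : Nat.card Fˣ = q - 1 := by
      rw [Nat.card_eq_fintype_card, Fintype.card_units, hF]
    obtain ⟨g, hg⟩ := IsCyclic.exists_generator (α := Fˣ)
    have hog : orderOf g = q - 1 := by
      rw [orderOf_eq_card_of_forall_mem_zpowers hg, hcard]
    obtain ⟨k, hk⟩ := hdvd
    have hprim : IsPrimitiveRoot (g : F) (q - 1) := by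
      rw [IsPrimitiveRoot.coe_units_iff, ← hog]
      exact IsPrimitiveRoot.orderOf g
    have hprim2 : IsPrimitiveRoot ((g : F) ^ k) d :=
      hprim.pow (by omega) (by rw [hk, mul_comm])
    have hHc := hprim2.card_nthRootsFinset
    have hmem : ∀ x : F, x ∈ Polynomial.nthRootsFinset d (1 : F) ↔ x ^ d = 1 :=
      fun x => Polynomial.mem_nthRootsFinset (by omega) 1
    generalize Polynomial.nthRootsFinset d (1 : F) = H at hHc hmem
    have h0 : (0 : F) ∉ H := by
      rw [hmem, zero_pow (by omega)]
      exact zero_ne_one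
    have hsub : H ⊆ Finset.univ.erase (0 : F) := by
      intro x hx
      simp only [Finset.mem_erase, Finset.mem_univ, and_true]
      rintro rfl
      exact h0 hx
    refine ⟨![H, H, Finset.univ.erase 0 \ H], ?_, ?_, ?_⟩
    · intro i
      fin_cases i <;> simp [h0]
    · intro i
      fin_cases i
      · simpa using hHc
      · simpa using hHc
      · show (Finset.univ.erase 0 \ H).card = q - d - 1
        rw [Finset.card_sdiff_of_subset hsub, Finset.card_erase_of_mem (Finset.mem_univ _),
          Finset.card_univ, hF, hHc]
        omega
    · intro a ha h
      have a0 : a 0 ∈ H := ha 0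
      have a1 : a 1 ∈ H := ha 1
      have a2 : a 2 ∈ Finset.univ.erase 0 \ H := ha 2
      rw [hmem] at a0 a1
      apply (Finset.mem_sdiff.1 a2).2
      rw [hmem]
      have h' : a 0 * a 1 * a 2 = 1 := by
        rw [Fin.prod_univ_three] at h
        rw [← h]; norm_num
      have := congrArg (· ^ d) h'
      simpa [mul_pow, a0, a1] using this
  · rintro F _ _ hF ⟨S, hS0, hSc, hS⟩
    have c0 : (S 0).card = d := hSc 0
    have c1 : (S 1).card = d := hSc 1
    have c2 : (S 2).card = q - d - 1 := hSc 2
    obtain ⟨b, hb⟩ : (S 1).Nonempty := Finset.card_pos.1 (by omega)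
    have hb0 : b ≠ 0 := fun h => hS0 1 (h ▸ hb)
    have hcT : ((S 0).image (fun a => (a * b)⁻¹)).card = d := by
      rw [Finset.card_image_of_injective _ ?_, c0]
      intro x y hxy
      exact mul_right_cancel₀ hb0 (inv_injective hxy)
    have hdisj : Disjoint ((S 0).image (fun a => (a * b)⁻¹)) (S 2) := by
      rw [Finset.disjoint_left]
      intro x hx hx2
      obtain ⟨a, ha, rfl⟩ := Finset.mem_image.1 hx
      have ha0 : a ≠ 0 := fun h => hS0 0 (h ▸ ha)
      refine hS ![a, b, (a * b)⁻¹] ?_ ?_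
      · intro i
        fin_cases i
        · exact ha
        · exact hb
        · exact hx2
      · rw [Fin.prod_univ_three]
        show (-1 : F) ^ 2 = a * b * (a * b)⁻¹
        rw [mul_inv_cancel₀ (mul_ne_zero ha0 hb0)]
        norm_num
    have hsub : (S 0).image (fun a => (a * b)⁻¹) ∪ S 2 ⊆ Finset.univ.erase (0 : F) := by
      intro x hx
      simp only [Finset.mem_erase, Finset.mem_univ, and_true]
      rintro rfl
      rcases Finset.mem_union.1 hx with h | h
      · obtain ⟨a, ha, h⟩ := Finset.mem_image.1 h
        have ha0 : a ≠ 0 := fun h => hS0 0 (h ▸ ha)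
        exact inv_ne_zero (mul_ne_zero ha0 hb0) h
      · exact hS0 2 h
    have := Finset.card_le_card hsub
    rw [Finset.card_union_of_disjoint hdisj, hcT, c2,
      Finset.card_erase_of_mem (Finset.mem_univ _), Finset.card_univ] at this
    have := Fintype.card_pos (α := F)
    omega
end
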